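/- arXiv:2406.16647 — 2 statements merged into one kernel-verified Lean document; each statement's English description precedes it below -/
import Mathlib

section
/- For every k ≥ 1, the complete graph K_8 is not a minor of the shallow-vortex grid V_k; that is, K_8 is not a shallow-vortex minor. (Result of Curticapean and Xia, stated in Section 1.1 of the paper.) -/
open SimpleGraph

/-- `H` is a minor of `G`: there is a family of pairwise disjoint nonempty subsets of `V(G)`,
one for each vertex of `H`, each inducing a connected subgraph of `G`, such that every edge
of `H` is realized by an edge of `G` between the corresponding branch sets. -/
def IsMinorOf {V : Type*} {W : Type*} (H : SimpleGraph V) (G : SimpleGraph W) : Prop :=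
  ∃ X : V → Set W,
    (∀ a, (X a).Nonempty) ∧
    (∀ a b, a ≠ b → Disjoint (X a) (X b)) ∧
    (∀ a, (G.induce (X a)).Connected) ∧
    ∀ a b, H.Adj a b → ∃ x ∈ X a, ∃ y ∈ X b, G.Adj x y

/-- The adjacency relation of the `(m, n)`-cylindrical grid: the Cartesian product of a path on
`m` vertices with a cycle on `n` vertices.  Vertex `v^i_j` is `(i, j)` (0-based first index,
second index taken in `ZMod n`). -/
def cylRel (m n : ℕ) (p q : Fin m × ZMod n) : Prop :=
  (p.1 = q.1 ∧ q.2 = p.2 + 1) ∨ (p.2 = q.2 ∧ (p.1 : ℕ) + 1 = (q.1 : ℕ))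

/-- The shallow-vortex grid `V_k`: the `(k, 4k)`-cylindrical grid together with, for each
`i < k`, the two crossing edges `v^1_{4i+1} v^1_{4i+3}` and `v^1_{4i+2} v^1_{4i+4}` on the
first cycle. -/
def shallowVortexGrid (k : ℕ) : SimpleGraph (Fin k × ZMod (4 * k)) :=
  SimpleGraph.fromRel fun p q =>
    cylRel k (4 * k) p q ∨
    ((p.1 : ℕ) = 0 ∧ (q.1 : ℕ) = 0 ∧ ∃ i < k,
      ((p.2 = ((4 * i + 1 : ℕ) : ZMod (4 * k)) ∧ q.2 = ((4 * i + 3 : ℕ) : ZMod (4 * k))) ∨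
       (p.2 = ((4 * i + 2 : ℕ) : ZMod (4 * k)) ∧ q.2 = ((4 * i + 4 : ℕ) : ZMod (4 * k)))))

/-- A mod-2 chain on the triangulated cylinder `ℕ × ZMod n`.  The edge with index `(t, i, j)` joins
`(i, j)` to `(i, j + 1)`, `(i + 1, j)` or `(i + 1, j + 1)` according to `t = 0, 1, 2`. -/
abbrev CylChain (n : ℕ) := Fin 3 → ℕ → ZMod n → ZMod 2

namespace CylChain

variable {n : ℕ}

/-- The second endpoint of the edge with index `(t, i, j)`. -/
def target (t : Fin 3) (i : ℕ) (j : ZMod n) : ℕ × ZMod n :=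
  match t with
  | 0 => (i, j + 1)
  | 1 => (i + 1, j)
  | 2 => (i + 1, j + 1)

/-- The degree of a chain at the vertex `(i + 1, j)`. -/
def degree (z : CylChain n) (i : ℕ) (j : ZMod n) : ZMod 2 :=
  z 0 (i + 1) (j - 1) + z 0 (i + 1) j + z 1 i j + z 1 (i + 1) j + z 2 i (j - 1) + z 2 (i + 1) j

/-- The chain consisting of a single edge. -/
def edge (t : Fin 3) (i : ℕ) (j : ZMod n) : CylChain n :=
  fun t' i' j' => if t' = t ∧ i' = i ∧ j' = j then 1 else 0

/-- The number of edges of `z` crossed by the ray from `(i, j)` towards higher layers. -/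
def ray (K : ℕ) (z : CylChain n) (i : ℕ) (j : ZMod n) : ZMod 2 :=
  ∑ a ∈ Finset.Ico (i + 1) K, (z 0 a j + z 2 a j)

/-- The parity of the number of edges of `z` separating `(i, j)` from the outer side of the
boundary edge between `(0, 0)` and `(0, 1)`. -/
def separation (K : ℕ) (z : CylChain n) (i : ℕ) (j : ZMod n) : ZMod 2 :=
  ∑ a ∈ Finset.range K, (z 0 a 0 + z 2 a 0) + ray K z i j

lemma separation_add (K : ℕ) (z w : CylChain n) (i : ℕ) (j : ZMod n) :
    separation K (z + w) i j = separation K z i j + separation K w i j := by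
  simp only [separation, ray, Pi.add_apply, Finset.sum_add_distrib]
  ring

lemma degree_add (z w : CylChain n) (i : ℕ) (j : ZMod n) :
    degree (z + w) i j = degree z i j + degree w i j := by
  simp only [degree, Pi.add_apply]
  ring

lemma ray_succ {k : ℕ} {z : CylChain n} (hz : ∀ t a b, k < a → z t a b = 0) (i : ℕ) (j : ZMod n) :
    ray (k + 2) z i j = z 0 (i + 1) j + z 2 (i + 1) j + ray (k + 2) z (i + 1) j := by
  unfold ray
  rcases lt_or_ge (i + 1) (k + 2) with h | h
  · rw [Finset.sum_eq_sum_Ico_succ_bot h]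
  · rw [Finset.Ico_eq_empty (by omega), Finset.Ico_eq_empty (by omega), hz 0 _ _ (by omega),
      hz 2 _ _ (by omega)]
    simp

lemma ray_add_ray {k : ℕ} {z : CylChain n} (hz : ∀ t a b, k < a → z t a b = 0)
    (hd : ∀ a b, degree z a b = 0) (i : ℕ) (j : ZMod n) :
    ray (k + 2) z i j + ray (k + 2) z i (j + 1) = z 2 i j + z 1 i (j + 1) := by
  by_cases h : k < i
  · unfold ray
    rw [Finset.Ico_eq_empty (by omega), hz 2 _ _ h, hz 1 _ _ h]
    simp
  · have ih := ray_add_ray hz hd (i + 1) j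
    rw [ray_succ hz i j, ray_succ hz i (j + 1)]
    have hdeg := hd i (j + 1)
    simp only [degree, add_sub_cancel_right] at hdeg
    grind
termination_by k + 1 - i

lemma separation_vertical {k : ℕ} {z : CylChain n} (hz : ∀ t a b, k < a → z t a b = 0)
    {i : ℕ} {j : ZMod n} (h0 : z 0 (i + 1) j = 0) (h2 : z 2 (i + 1) j = 0) :
    separation (k + 2) z i j = separation (k + 2) z (i + 1) j := by
  simp [separation, ray_succ hz i j, h0, h2]

lemma separation_horizontal {k : ℕ} {z : CylChain n} (hz : ∀ t a b, k < a → z t a b = 0)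
    (hd : ∀ a b, degree z a b = 0) {i : ℕ} {j : ZMod n} (h2 : z 2 i j = 0)
    (h1 : z 1 i (j + 1) = 0) :
    separation (k + 2) z i j = separation (k + 2) z i (j + 1) := by
  have h := ray_add_ray hz hd i j
  rw [h1, h2, add_zero, CharTwo.add_eq_zero] at h
  simp [separation, h]

lemma separation_edge (K : ℕ) (t : Fin 3) {i : ℕ} (hi : i < K) (j : ZMod n) (a : ℕ) (b : ZMod n) :
    separation K (edge t i j) a b =
      if t = 1 then 0 else (if j = 0 then 1 else 0) + if a < i ∧ b = j then 1 else 0 := by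
  have key : ∀ (s : Finset ℕ) (c : ZMod n),
      ∑ x ∈ s, (edge t i j 0 x c + edge t i j 2 x c) =
        if t ≠ 1 ∧ i ∈ s ∧ c = j then 1 else 0 := by
    intro s c
    have : ∀ x, edge t i j 0 x c + edge t i j 2 x c =
        if x = i then (if t ≠ 1 ∧ c = j then 1 else 0) else 0 := by
      intro x
      fin_cases t <;> simp [edge] <;> grind
    simp only [this, Finset.sum_ite_eq']
    grind
  unfold separation ray
  rw [key, key]
  simp only [Finset.mem_range, Finset.mem_Ico]
  by_cases ht : t = 1
  · simp [ht]
  · simp [ht, hi, eq_comm]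

lemma degree_edge (t : Fin 3) (i : ℕ) (j : ZMod n) (a : ℕ) (b : ZMod n) :
    degree (edge t i j) a b =
      (if i = a + 1 ∧ j = b then 1 else 0) + if target t i j = (a + 1, b) then 1 else 0 := by
  have hb : b - 1 = j ↔ j + 1 = b := by grind
  fin_cases t <;> simp [degree, edge, target, hb, Prod.ext_iff, eq_comm] <;> grind

/-- `z` is a path from `(i, j)` to layer `0`, all of whose vertices carry only labels in `A`. -/
structure IsLeg {α : Type*} (k : ℕ) (lab : ℕ → ZMod n → Set α) (A : Finset α) (i : ℕ) (j : ZMod n)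
    (z : CylChain n) : Prop where
  support : ∀ t a b, z t a b ≠ 0 →
    lab a b ⊆ A ∧ lab (target t a b).1 (target t a b).2 ⊆ A
  degree_eq : ∀ a b, degree z a b = if i = a + 1 ∧ j = b then 1 else 0
  label_subset : lab i j ⊆ A
  bound : ∀ t a b, k < a → z t a b = 0

variable {α : Type*} {k : ℕ} {lab : ℕ → ZMod n → Set α}

lemma IsLeg.mono {A B : Finset α} {i : ℕ} {j : ZMod n} {z : CylChain n} (h : IsLeg k lab A i j z)
    (hAB : A ⊆ B) : IsLeg k lab B i j z where
  support t a b hz := ⟨(h.support t a b hz).1.trans (by exact_mod_cast hAB),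
    (h.support t a b hz).2.trans (by exact_mod_cast hAB)⟩
  degree_eq := h.degree_eq
  label_subset := h.label_subset.trans (by exact_mod_cast hAB)
  bound := h.bound

lemma isLeg_zero {A : Finset α} {j : ZMod n} (h : lab 0 j ⊆ A) : IsLeg k lab A 0 j 0 where
  support t a b hz := by simp at hz
  degree_eq a b := by simp [degree]
  label_subset := h
  bound := by simp

lemma IsLeg.support_cut {A B : Finset α} [DecidableEq α] {i i' : ℕ} {j j' : ZMod n}
    {z w : CylChain n} {t : Fin 3}
    (hz : IsLeg k lab A i j z) (hw : IsLeg k lab B i' j' w) (ht : target t i j = (i', j'))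
    (s : Fin 3) (a : ℕ) (b : ZMod n) (hne : (z + w + edge t i j) s a b ≠ 0) :
    lab a b ⊆ (A ∪ B : Finset α) ∧
      lab (target s a b).1 (target s a b).2 ⊆ (A ∪ B : Finset α) := by
  have hz' := hz.mono (Finset.subset_union_left (s₂ := B))
  have hw' := hw.mono (Finset.subset_union_right (s₁ := A))
  by_cases h1 : z s a b = 0
  · by_cases h2 : w s a b = 0
    · have h3 : edge t i j s a b ≠ 0 := by simpa [h1, h2] using hne
      simp only [edge, ne_eq, ite_eq_right_iff, one_ne_zero, imp_false, not_not] at h3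
      obtain ⟨rfl, rfl, rfl⟩ := h3
      exact ⟨hz'.label_subset, by simpa [ht] using hw'.label_subset⟩
    · exact hw'.support s a b h2
  · exact hz'.support s a b h1

lemma IsLeg.degree_cut {A B : Finset α} {i i' : ℕ} {j j' : ZMod n}
    {z w : CylChain n} {t : Fin 3}
    (hz : IsLeg k lab A i j z) (hw : IsLeg k lab B i' j' w) (ht : target t i j = (i', j'))
    (a : ℕ) (b : ZMod n) : degree (z + w + edge t i j) a b = 0 := by
  rw [degree_add, degree_add, hz.degree_eq, hw.degree_eq, degree_edge, ht]
  simp only [Prod.mk.injEq]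
  grind

lemma IsLeg.bound_cut {A B : Finset α} {i i' : ℕ} {j j' : ZMod n}
    {z w : CylChain n} {t : Fin 3}
    (hz : IsLeg k lab A i j z) (hw : IsLeg k lab B i' j' w) (hi : i ≤ k)
    (s : Fin 3) (a : ℕ) (b : ZMod n) (ha : k < a) : (z + w + edge t i j) s a b = 0 := by
  have : edge t i j s a b = 0 := by
    simp only [edge, ite_eq_right_iff, one_ne_zero, imp_false]
    omega
  simp [hz.bound s a b ha, hw.bound s a b ha, this]

/-- `(i, j)` is joined to layer `0` by a path meeting only labels in `A`. -/
def HasLeg (k : ℕ) (lab : ℕ → ZMod n → Set α) (A : Finset α) (i : ℕ) (j : ZMod n) : Prop :=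
  ∃ z, IsLeg k lab A i j z

lemma HasLeg.of_target {A : Finset α} {i i' : ℕ} {j j' : ZMod n} {t : Fin 3}
    (h : HasLeg k lab A i' j') (ht : target t i j = (i', j')) (hi : i ≤ k)
    (hlab : lab i j ⊆ A) : HasLeg k lab A i j := by
  obtain ⟨z, hz⟩ := h
  refine ⟨z + edge t i j, ?_, ?_, hlab, ?_⟩
  · intro s a b hne
    by_cases h1 : z s a b = 0
    · have h3 : edge t i j s a b ≠ 0 := by simpa [h1] using hne
      simp only [edge, ne_eq, ite_eq_right_iff, one_ne_zero, imp_false, not_not] at h3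
      obtain ⟨rfl, rfl, rfl⟩ := h3
      exact ⟨hlab, by simpa [ht] using hz.label_subset⟩
    · exact hz.support s a b h1
  · intro a b
    rw [degree_add, hz.degree_eq, degree_edge, ht]
    simp only [Prod.mk.injEq]
    grind
  · intro s a b ha
    have : edge t i j s a b = 0 := by
      simp only [edge, ite_eq_right_iff, one_ne_zero, imp_false]
      omega
    simp [hz.bound s a b ha, this]

lemma HasLeg.of_source {A : Finset α} {i i' : ℕ} {j j' : ZMod n} {t : Fin 3}
    (h : HasLeg k lab A i j) (ht : target t i j = (i', j')) (hi : i ≤ k)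
    (hlab : lab i' j' ⊆ A) : HasLeg k lab A i' j' := by
  obtain ⟨z, hz⟩ := h
  refine ⟨z + edge t i j, ?_, ?_, hlab, ?_⟩
  · intro s a b hne
    by_cases h1 : z s a b = 0
    · have h3 : edge t i j s a b ≠ 0 := by simpa [h1] using hne
      simp only [edge, ne_eq, ite_eq_right_iff, one_ne_zero, imp_false, not_not] at h3
      obtain ⟨rfl, rfl, rfl⟩ := h3
      exact ⟨hz.label_subset, by simpa [ht] using hlab⟩
    · exact hz.support s a b h1
  · intro a b
    rw [degree_add, hz.degree_eq, degree_edge, ht]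
    simp only [Prod.mk.injEq]
    grind
  · intro s a b ha
    have : edge t i j s a b = 0 := by
      simp only [edge, ite_eq_right_iff, one_ne_zero, imp_false]
      omega
    simp [hz.bound s a b ha, this]

/-- Let the vertices of the triangulated cylinder carry labels such that, for every `B`, the
representatives of the labels outside `B` lie in one component of the subgraph of the grid formed by
the vertices carrying a label outside `B`.  Let every vertex have a leg meeting only the labels in
`A i j`, trivial on layer `0`.  Then it is impossible that the legs of each triangle, and those of
the top cycle, miss a common label. -/
theorem false_of_forall_face_misses_label [NeZero n] [DecidableEq α]
    (rep : α → ℕ × ZMod n) (hrep : ∀ c, c ∈ lab (rep c).1 (rep c).2)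
    (hrepk : ∀ c, (rep c).1 < k)
    (hconn : ∀ (B : Finset α) (f : ℕ → ZMod n → ZMod 2),
      (∀ i j, ¬ lab i j ⊆ B → ¬ lab (i + 1) j ⊆ B → f i j = f (i + 1) j) →
      (∀ i j, ¬ lab i j ⊆ B → ¬ lab i (j + 1) ⊆ B → f i j = f i (j + 1)) →
      ∀ c c', c ∉ B → c' ∉ B → f (rep c).1 (rep c).2 = f (rep c').1 (rep c').2)
    (A : ℕ → ZMod n → Finset α) (leg : ℕ → ZMod n → CylChain n)
    (hleg : ∀ i ≤ k, ∀ j, IsLeg k lab (A i j) i j (leg i j))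
    (hleg0 : ∀ j, leg 0 j = 0)
    (htop : ∃ c, ∀ j, c ∉ A k j)
    (hlower : ∀ i < k, ∀ j, ∃ c, c ∉ A i j ∪ A (i + 1) j ∪ A (i + 1) (j + 1))
    (hupper : ∀ i < k, ∀ j, ∃ c, c ∉ A i j ∪ A i (j + 1) ∪ A (i + 1) (j + 1)) : False := by
  have hindep : ∀ (t : Fin 3) (i : ℕ) (j : ZMod n) (i' : ℕ) (j' : ZMod n), i ≤ k → i' ≤ k →
      target t i j = (i', j') → ∀ c c', c ∉ A i j ∪ A i' j' → c' ∉ A i j ∪ A i' j' →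
      separation (k + 2) (leg i j + leg i' j' + edge t i j) (rep c).1 (rep c).2 =
      separation (k + 2) (leg i j + leg i' j' + edge t i j) (rep c').1 (rep c').2 := by
    intro t i j i' j' hi hi' ht
    have hsupp := (hleg i hi j).support_cut (hleg i' hi' j') ht
    have hbd := (hleg i hi j).bound_cut (hleg i' hi' j') (t := t) hi
    have hdg := (hleg i hi j).degree_cut (hleg i' hi' j') ht
    apply hconn
    · intro a b _ h2
      apply separation_vertical hbd
      · by_contra hne
        exact h2 (hsupp 0 _ _ hne).1
      · by_contra hne
        exact h2 (hsupp 2 _ _ hne).1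
    · intro a b h1 h2
      apply separation_horizontal hbd hdg
      · by_contra hne
        exact h1 (hsupp 2 _ _ hne).1
      · by_contra hne
        exact h2 (hsupp 1 _ _ hne).1
  have hchoose : ∀ (t : Fin 3) (i : ℕ) (j : ZMod n), ∃ φ : ZMod 2, ∀ i' j', i ≤ k → i' ≤ k →
      target t i j = (i', j') → ∀ c, c ∉ A i j ∪ A i' j' →
      separation (k + 2) (leg i j + leg i' j' + edge t i j) (rep c).1 (rep c).2 = φ := by
    intro t i j
    by_cases hc : ∃ c, c ∉ A i j ∪ A (target t i j).1 (target t i j).2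
    · obtain ⟨c, hc⟩ := hc
      refine ⟨separation (k + 2) (leg i j + leg (target t i j).1 (target t i j).2 + edge t i j)
        (rep c).1 (rep c).2, ?_⟩
      intro i' j' hi hi' ht c' hc'
      rw [ht] at hc ⊢
      exact hindep t i j i' j' hi hi' ht c' c hc' hc
    · push Not at hc
      refine ⟨0, ?_⟩
      intro i' j' hi hi' ht c' hc'
      have := hc c'
      rw [ht] at this
      exact absurd this hc'
  choose φ hφ using hchoose
  have hT1 : ∀ i < k, ∀ j, φ 1 i j + φ 0 (i + 1) j + φ 2 i j = 0 := by
    intro i hi j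
    obtain ⟨c, hc⟩ := hlower i hi j
    simp only [Finset.mem_union, not_or] at hc
    rw [← hφ 1 i j (i + 1) j hi.le hi rfl c (by simp [hc]),
      ← hφ 0 (i + 1) j (i + 1) (j + 1) hi hi rfl c (by simp [hc]),
      ← hφ 2 i j (i + 1) (j + 1) hi.le hi rfl c (by simp [hc])]
    simp only [separation_add]
    rw [separation_edge _ _ (by omega), separation_edge _ _ (by omega),
      separation_edge _ _ (by omega)]
    have hne : ¬ ((rep c).1 = i ∧ (rep c).2 = j) := by
      rintro ⟨h1, h2⟩
      have h := hrep c
      rw [h1, h2] at h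
      exact hc.1.1 (by simpa using (hleg i hi.le j).label_subset h)
    have h3 : ((rep c).1 < i + 1 ∧ (rep c).2 = j) ↔ ((rep c).1 < i ∧ (rep c).2 = j) := by
      constructor
      · rintro ⟨h1, h2⟩
        exact ⟨lt_of_le_of_ne (Nat.lt_succ_iff.1 h1) fun h => hne ⟨h, h2⟩, h2⟩
      · rintro ⟨h1, h2⟩
        exact ⟨by omega, h2⟩
    simp only [h3]
    norm_num
    grind
  have hT2 : ∀ i < k, ∀ j, φ 0 i j + φ 1 i (j + 1) + φ 2 i j = 0 := by
    intro i hi j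
    obtain ⟨c, hc⟩ := hupper i hi j
    simp only [Finset.mem_union, not_or] at hc
    rw [← hφ 0 i j i (j + 1) hi.le hi.le rfl c (by simp [hc]),
      ← hφ 1 i (j + 1) (i + 1) (j + 1) hi.le hi rfl c (by simp [hc]),
      ← hφ 2 i j (i + 1) (j + 1) hi.le hi rfl c (by simp [hc])]
    simp only [separation_add]
    rw [separation_edge _ _ (by omega), separation_edge _ _ (by omega),
      separation_edge _ _ (by omega)]
    norm_num
    grind
  have hshift : ∀ g : ZMod n → ZMod 2, ∑ j, g (j + 1) = ∑ j, g j := fun g =>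
    Equiv.sum_comp (Equiv.addRight (1 : ZMod n)) g
  have hsum : ∀ i ≤ k, ∑ j, φ 0 i j = ∑ j, φ 0 0 j := by
    intro i
    induction i with
    | zero => simp
    | succ i ih =>
      intro hi
      rw [← ih (by omega)]
      have h : ∑ j, (φ 0 (i + 1) j + φ 0 i j + (φ 1 i j + φ 1 i (j + 1))) = 0 := by
        apply Finset.sum_eq_zero
        intro j _
        have h1 := hT1 i hi j
        have h2 := hT2 i hi j
        grind
      rw [Finset.sum_add_distrib, Finset.sum_add_distrib, Finset.sum_add_distrib,
        hshift (φ 1 i), CharTwo.add_self_eq_zero, add_zero, CharTwo.add_eq_zero] at h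
      exact h
  have hbot : ∑ j, φ 0 0 j = 1 := by
    have : ∀ j, φ 0 0 j = if j = 0 then 1 else 0 := by
      intro j
      obtain ⟨c₀, _⟩ := htop
      have hk : 0 < k := (Nat.zero_le _).trans_lt (hrepk c₀)
      obtain ⟨c, hc⟩ := hupper 0 hk j
      simp only [Finset.mem_union, not_or] at hc
      rw [← hφ 0 0 j 0 (j + 1) (Nat.zero_le k) (Nat.zero_le k) rfl c (by simp [hc]), hleg0, hleg0,
        add_zero, zero_add, separation_edge _ _ (Nat.succ_pos _)]
      simp
    simp [this]
  have htop' : ∑ j, φ 0 k j = 0 := by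
    obtain ⟨c, hc⟩ := htop
    have : ∀ j, φ 0 k j = separation (k + 2) (leg k j) (rep c).1 (rep c).2 +
        separation (k + 2) (leg k (j + 1)) (rep c).1 (rep c).2 +
        ((if j = 0 then 1 else 0) + if j = (rep c).2 then 1 else 0) := by
      intro j
      rw [← hφ 0 k j k (j + 1) le_rfl le_rfl rfl c (by simp [hc]), separation_add, separation_add,
        separation_edge _ _ (by omega : k < k + 2)]
      simp [hrepk c, eq_comm]
    simp only [this, Finset.sum_add_distrib,
      hshift (fun j => separation (k + 2) (leg k j) (rep c).1 (rep c).2)]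
    simp [CharTwo.add_self_eq_zero]
  have := hsum k le_rfl
  rw [hbot, htop'] at this
  exact zero_ne_one this

end CylChain

namespace ShallowVortex

open CylChain

variable {k : ℕ}

/-- The two middle positions `4i + 2`, `4i + 3` of a cross are sent to the outer positions `4i + 1`,
`4i + 4` next to them; all other positions are fixed. -/
def partner (j : ZMod (4 * k)) : ZMod (4 * k) :=
  if j.val % 4 = 2 then j - 1 else if j.val % 4 = 3 then j + 1 else j

lemma partner_two {i : ℕ} (hi : i < k) :
    partner ((4 * i + 2 : ℕ) : ZMod (4 * k)) = ((4 * i + 1 : ℕ) : ZMod (4 * k)) := by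
  have hval : ((4 * i + 2 : ℕ) : ZMod (4 * k)).val = 4 * i + 2 := ZMod.val_cast_of_lt (by omega)
  rw [partner, hval, if_pos (by omega)]
  push_cast
  ring

lemma partner_three {i : ℕ} (hi : i < k) :
    partner ((4 * i + 3 : ℕ) : ZMod (4 * k)) = ((4 * i + 4 : ℕ) : ZMod (4 * k)) := by
  have hval : ((4 * i + 3 : ℕ) : ZMod (4 * k)).val = 4 * i + 3 := ZMod.val_cast_of_lt (by omega)
  rw [partner, hval, if_neg (by omega), if_pos (by omega)]
  push_cast
  ring

variable {α : Type*} (X : α → Set (Fin k × ZMod (4 * k)))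

/-- The branch sets at a vertex, where a vertex of the first cycle also receives the branch set
of its partner.  In this way every crossing edge is replaced by a path in the grid. -/
def label (i : ℕ) (j : ZMod (4 * k)) : Set α :=
  {c | ∃ h : i < k, (⟨i, h⟩, j) ∈ X c ∨ i = 0 ∧ (⟨i, h⟩, partner j) ∈ X c}

variable {X}

lemma mem_label {p : Fin k × ZMod (4 * k)} {c : α} (h : p ∈ X c) : c ∈ label X p.1 p.2 :=
  ⟨p.1.2, Or.inl h⟩

lemma eq_of_mem (hX : ∀ a b, a ≠ b → Disjoint (X a) (X b))
    {p : Fin k × ZMod (4 * k)} {a b : α} (ha : p ∈ X a) (hb : p ∈ X b) : a = b := by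
  by_contra h
  exact Set.disjoint_left.1 (hX a b h) ha hb

lemma exists_eq_of_mem [Nonempty α] (hX : ∀ a b, a ≠ b → Disjoint (X a) (X b))
    (p : Fin k × ZMod (4 * k)) : ∃ a, ∀ c, p ∈ X c → c = a := by
  by_cases h : ∃ a, p ∈ X a
  · obtain ⟨a, ha⟩ := h
    exact ⟨a, fun c hc => eq_of_mem hX hc ha⟩
  · exact ⟨Classical.arbitrary α, fun c hc => absurd ⟨c, hc⟩ h⟩

lemma label_zero_subset [Nonempty α] (hX : ∀ a b, a ≠ b → Disjoint (X a) (X b))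
    (j : ZMod (4 * k)) : ∃ a b, label X 0 j ⊆ {a, b} := by
  by_cases h : 0 < k
  · obtain ⟨a, ha⟩ := exists_eq_of_mem hX (⟨0, h⟩, j)
    obtain ⟨b, hb⟩ := exists_eq_of_mem hX (⟨0, h⟩, partner j)
    refine ⟨a, b, ?_⟩
    rintro c ⟨h', hc | ⟨-, hc⟩⟩
    · exact Or.inl (ha c hc)
    · exact Or.inr (hb c hc)
  · exact ⟨Classical.arbitrary α, Classical.arbitrary α, fun c ⟨h', _⟩ => absurd h' h⟩

lemma label_subset_of_mem [Nonempty α] (hX : ∀ a b, a ≠ b → Disjoint (X a) (X b))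
    {p : Fin k × ZMod (4 * k)} {c : α} (hc : p ∈ X c) :
    ∃ s, label X p.1 p.2 ⊆ {c, s} := by
  obtain ⟨b, hb⟩ := exists_eq_of_mem hX (p.1, partner p.2)
  refine ⟨b, ?_⟩
  rintro d ⟨h', hd | ⟨-, hd⟩⟩
  · exact Or.inl (eq_of_mem hX hd hc)
  · exact Or.inr (hb d hd)

lemma label_subset_singleton_of_mem (hX : ∀ a b, a ≠ b → Disjoint (X a) (X b))
    {p : Fin k × ZMod (4 * k)} {c : α} (hc : p ∈ X c)
    (hp : (p.1 : ℕ) ≠ 0) :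
    label X p.1 p.2 ⊆ {c} := by
  rintro d ⟨h', hd | ⟨h0, -⟩⟩
  · exact eq_of_mem hX hd hc
  · exact absurd h0 hp

lemma adj_cases {p q : Fin k × ZMod (4 * k)}
    {P : Fin k × ZMod (4 * k) → Fin k × ZMod (4 * k) → Prop}
    (h : (shallowVortexGrid k).Adj p q) (hsymm : ∀ p q, P p q → P q p)
    (hgrid : ∀ p q (t : Fin 3), target t (p.1 : ℕ) p.2 = ((q.1 : ℕ), q.2) → t ≠ 2 → P p q)
    (hcross : ∀ i < k, ∀ h : 0 < k,
      P (⟨0, h⟩, ((4 * i + 1 : ℕ) : ZMod (4 * k))) (⟨0, h⟩, ((4 * i + 3 : ℕ) : ZMod (4 * k))))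
    (hcross' : ∀ i < k, ∀ h : 0 < k,
      P (⟨0, h⟩, ((4 * i + 2 : ℕ) : ZMod (4 * k))) (⟨0, h⟩, ((4 * i + 4 : ℕ) : ZMod (4 * k)))) :
    P p q := by
  have key : ∀ p q : Fin k × ZMod (4 * k), (cylRel k (4 * k) p q ∨
    ((p.1 : ℕ) = 0 ∧ (q.1 : ℕ) = 0 ∧ ∃ i < k,
      ((p.2 = ((4 * i + 1 : ℕ) : ZMod (4 * k)) ∧ q.2 = ((4 * i + 3 : ℕ) : ZMod (4 * k))) ∨
       (p.2 = ((4 * i + 2 : ℕ) : ZMod (4 * k)) ∧ q.2 = ((4 * i + 4 : ℕ) : ZMod (4 * k)))))) →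
      P p q := by
    rintro ⟨a, b⟩ ⟨c, d⟩ ((⟨h1, h2⟩ | ⟨h1, h2⟩) | ⟨h1, h2, i, hi, ⟨h3, h4⟩ | ⟨h3, h4⟩⟩)
    · exact hgrid _ _ 0 (by simp_all [target]) (by decide)
    · exact hgrid _ _ 1 (by simp_all [target]) (by decide)
    all_goals
      have hk : 0 < k := by omega
      have ha : a = ⟨0, hk⟩ := Fin.ext h1
      have hc : c = ⟨0, hk⟩ := Fin.ext h2
      simp only at h3 h4
      subst ha hc h3 h4
    · exact hcross i hi hk
    · exact hcross' i hi hk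
  rw [shallowVortexGrid, SimpleGraph.fromRel_adj] at h
  rcases h.2 with h | h
  · exact key _ _ h
  · exact hsymm _ _ (key _ _ h)

lemma eq_of_adj {B : Finset α} {f : ℕ → ZMod (4 * k) → ZMod 2}
    (hv : ∀ i j, ¬ label X i j ⊆ B → ¬ label X (i + 1) j ⊆ B → f i j = f (i + 1) j)
    (hh : ∀ i j, ¬ label X i j ⊆ B → ¬ label X i (j + 1) ⊆ B → f i j = f i (j + 1))
    {p q : Fin k × ZMod (4 * k)} (h : (shallowVortexGrid k).Adj p q)
    (hp : ∃ c ∉ B, p ∈ X c) (hq : ∃ c ∉ B, q ∈ X c) : f p.1 p.2 = f q.1 q.2 := by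
  have free : ∀ p : Fin k × ZMod (4 * k), (∃ c ∉ B, p ∈ X c) → ¬ label X p.1 p.2 ⊆ B := by
    rintro p ⟨c, hc, hpc⟩ hsub
    exact hc (hsub (mem_label hpc))
  revert hp hq
  refine adj_cases (P := fun p q => (∃ c ∉ B, p ∈ X c) → (∃ c ∉ B, q ∈ X c) →
    f p.1 p.2 = f q.1 q.2) h (fun p q h h1 h2 => (h h2 h1).symm) ?_ ?_ ?_
  · rintro ⟨a, b⟩ ⟨c, d⟩ t ht h2 hp hq
    have hp := free _ hp
    have hq := free _ hq
    fin_cases t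
    · simp only [target, Prod.mk.injEq] at ht hp hq ⊢
      rw [← ht.1, ← ht.2] at hq ⊢
      exact hh _ _ hp hq
    · simp only [target, Prod.mk.injEq] at ht hp hq ⊢
      rw [← ht.1, ← ht.2] at hq ⊢
      exact hv _ _ hp hq
    · simp at h2
  · intro i hi h0 hp hq
    have hmid : ¬ label X 0 ((4 * i + 2 : ℕ) : ZMod (4 * k)) ⊆ B := by
      obtain ⟨c, hc, hpc⟩ := hp
      exact fun hsub => hc (hsub ⟨h0, Or.inr ⟨rfl, by rwa [partner_two hi]⟩⟩)
    have h1 := hh 0 ((4 * i + 1 : ℕ) : ZMod (4 * k)) (free _ hp)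
    have h2 := hh 0 ((4 * i + 2 : ℕ) : ZMod (4 * k)) hmid
    rw [← Nat.cast_succ] at h1 h2
    exact (h1 hmid).trans (h2 (free _ hq))
  · intro i hi h0 hp hq
    have hmid : ¬ label X 0 ((4 * i + 3 : ℕ) : ZMod (4 * k)) ⊆ B := by
      obtain ⟨c, hc, hpc⟩ := hq
      exact fun hsub => hc (hsub ⟨h0, Or.inr ⟨rfl, by rwa [partner_three hi]⟩⟩)
    have h1 := hh 0 ((4 * i + 2 : ℕ) : ZMod (4 * k)) (free _ hp)
    have h2 := hh 0 ((4 * i + 3 : ℕ) : ZMod (4 * k)) hmid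
    rw [← Nat.cast_succ] at h1 h2
    exact (h1 hmid).trans (h2 (free _ hq))

lemma hasLeg_of_adj {A : Finset α} {p q : Fin k × ZMod (4 * k)}
    (h : (shallowVortexGrid k).Adj p q) (hp : (p.1 : ℕ) ≠ 0) (hA : label X p.1 p.2 ⊆ A)
    (hq : HasLeg k (label X) A q.1 q.2) : HasLeg k (label X) A p.1 p.2 := by
  have := adj_cases (P := fun p q =>
    ((p.1 : ℕ) ≠ 0 → label X p.1 p.2 ⊆ A → HasLeg k (label X) A q.1 q.2 →
      HasLeg k (label X) A p.1 p.2) ∧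
    ((q.1 : ℕ) ≠ 0 → label X q.1 q.2 ⊆ A → HasLeg k (label X) A p.1 p.2 →
      HasLeg k (label X) A q.1 q.2)) h (fun p q h => h.symm) ?_ ?_ ?_
  · exact this.1 hp hA hq
  · intro p q t ht _
    exact ⟨fun _ hl hq => hq.of_target ht p.1.2.le hl, fun _ hl hp => hp.of_source ht p.1.2.le hl⟩
  · exact fun i hi h0 => ⟨fun h => absurd rfl h, fun h => absurd rfl h⟩
  · exact fun i hi h0 => ⟨fun h => absurd rfl h, fun h => absurd rfl h⟩

lemma hasLeg_zero {A : Finset α} {p : Fin k × ZMod (4 * k)} (hp : (p.1 : ℕ) = 0)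
    (hA : label X p.1 p.2 ⊆ A) : HasLeg k (label X) A p.1 p.2 := by
  rw [hp] at hA ⊢
  exact ⟨0, isLeg_zero hA⟩

lemma eq_of_connected {B : Finset α} {f : ℕ → ZMod (4 * k) → ZMod 2}
    (hv : ∀ i j, ¬ label X i j ⊆ B → ¬ label X (i + 1) j ⊆ B → f i j = f (i + 1) j)
    (hh : ∀ i j, ¬ label X i j ⊆ B → ¬ label X i (j + 1) ⊆ B → f i j = f i (j + 1))
    {c : α} (hcB : c ∉ B) (hc : ((shallowVortexGrid k).induce (X c)).Connected)
    {p q : Fin k × ZMod (4 * k)} (hp : p ∈ X c) (hq : q ∈ X c) : f p.1 p.2 = f q.1 q.2 := by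
  obtain ⟨w⟩ := hc.preconnected ⟨p, hp⟩ ⟨q, hq⟩
  have : ∀ {u v : X c} (w : ((shallowVortexGrid k).induce (X c)).Walk u v),
      f u.1.1 u.1.2 = f v.1.1 v.1.2 := by
    intro u v w
    induction w with
    | nil => rfl
    | @cons u v _ huv _ ih =>
      exact (eq_of_adj hv hh (SimpleGraph.induce_adj.1 huv) ⟨c, hcB, u.2⟩ ⟨c, hcB, v.2⟩).trans ih
  exact this w

variable [DecidableEq α]

/-- A leg starting next to a vertex of `X c` can be prolonged to that vertex, at the cost of
replacing the leg by a trivial one on the first cycle. -/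
lemma exists_hasLeg_of_adj [Nonempty α] (hX : ∀ a b, a ≠ b → Disjoint (X a) (X b)) {o c : α}
    {p q : Fin k × ZMod (4 * k)} (h : (shallowVortexGrid k).Adj p q) (hp : p ∈ X c)
    (hq : ∃ s, HasLeg k (label X) {o, c, s} q.1 q.2) :
    ∃ s, HasLeg k (label X) {o, c, s} p.1 p.2 := by
  by_cases h0 : (p.1 : ℕ) = 0
  · obtain ⟨s, hs⟩ := label_subset_of_mem hX hp
    refine ⟨s, hasLeg_zero h0 (hs.trans ?_)⟩
    intro x hx
    simp only [Finset.coe_insert, Finset.coe_singleton]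
    exact Or.inr hx
  · obtain ⟨s, hs⟩ := hq
    refine ⟨s, hasLeg_of_adj h h0 ((label_subset_singleton_of_mem hX hp h0).trans ?_) hs⟩
    simp

lemma exists_hasLeg_of_connected [Nonempty α] (hX : ∀ a b, a ≠ b → Disjoint (X a) (X b))
    {o c : α} (hc : ((shallowVortexGrid k).induce (X c)).Connected) {q : Fin k × ZMod (4 * k)}
    (hq : q ∈ X c) (hleg : ∃ s, HasLeg k (label X) {o, c, s} q.1 q.2)
    {p : Fin k × ZMod (4 * k)} (hp : p ∈ X c) : ∃ s, HasLeg k (label X) {o, c, s} p.1 p.2 := by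
  obtain ⟨w⟩ := hc.preconnected ⟨p, hp⟩ ⟨q, hq⟩
  have : ∀ {u v : X c} (w : ((shallowVortexGrid k).induce (X c)).Walk u v),
      (∃ s, HasLeg k (label X) {o, c, s} v.1.1 v.1.2) →
      ∃ s, HasLeg k (label X) {o, c, s} u.1.1 u.1.2 := by
    intro u v w
    induction w with
    | nil => exact id
    | @cons u v _ huv _ ih =>
      intro h
      exact exists_hasLeg_of_adj hX (SimpleGraph.induce_adj.1 huv) u.2 (ih h)
  exact this w hleg

/-- Some label `o` can be chosen such that every vertex has a leg meeting at most two labels other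
than `o`. -/
lemma exists_hasLeg [Nonempty α] (hne : ∀ a, (X a).Nonempty)
    (hX : ∀ a b, a ≠ b → Disjoint (X a) (X b))
    (hc : ∀ a, ((shallowVortexGrid k).induce (X a)).Connected)
    (hadj : ∀ a b, a ≠ b → ∃ x ∈ X a, ∃ y ∈ X b, (shallowVortexGrid k).Adj x y) :
    ∃ o, ∀ i ≤ k, ∀ j, ∃ a b, HasLeg k (label X) {o, a, b} i j := by
  classical
  have hex : ∃ i, ∃ j, (label X i j).Nonempty := by
    obtain ⟨p, hp⟩ := hne (Classical.arbitrary α)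
    exact ⟨_, _, _, mem_label hp⟩
  obtain ⟨j₀, hj₀⟩ := Nat.find_spec hex
  have hmin : ∀ i < Nat.find hex, ∀ j, label X i j = ∅ := by
    intro i hi j
    by_contra h
    exact Nat.find_min hex hi ⟨j, Set.nonempty_iff_ne_empty.2 h⟩
  obtain ⟨o, p₀, hp₀, hpo⟩ : ∃ o, ∃ p : Fin k × ZMod (4 * k),
      (p.1 : ℕ) = Nat.find hex ∧ p ∈ X o := by
    obtain ⟨o, h, ho | ⟨-, ho⟩⟩ := hj₀
    · exact ⟨o, _, rfl, ho⟩
    · exact ⟨o, _, rfl, ho⟩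
  have hbase : ∃ s, HasLeg k (label X) {o, o, s} p₀.1 p₀.2 := by
    by_cases h0 : (p₀.1 : ℕ) = 0
    · obtain ⟨s, hs⟩ := label_subset_of_mem hX hpo
      exact ⟨s, hasLeg_zero h0 (by simpa using hs)⟩
    · refine ⟨o, ?_⟩
      have hlow : ∀ i < Nat.find hex, HasLeg k (label X) {o, o, o} i p₀.2 := by
        intro i
        induction i with
        | zero => exact fun hi => ⟨0, isLeg_zero (by simp [hmin 0 hi])⟩
        | succ i ih =>
          intro hi
          exact (ih (by omega)).of_source (t := 1) rfl (by omega) (by simp [hmin _ hi])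
      have := hlow ((p₀.1 : ℕ) - 1) (by omega)
      refine this.of_source (t := 1) ?_ (by omega)
        ((label_subset_singleton_of_mem hX hpo h0).trans (by simp))
      simp only [target, Prod.mk.injEq, and_true]
      omega
  have ho : ∀ p ∈ X o, ∃ s, HasLeg k (label X) {o, o, s} p.1 p.2 := fun p hp =>
    exists_hasLeg_of_connected hX (hc o) hpo hbase hp
  have hall : ∀ c, ∀ p ∈ X c, ∃ s, HasLeg k (label X) {o, c, s} p.1 p.2 := by
    intro c p hp
    by_cases hco : c = o
    · subst hco
      exact ho p hp
    · obtain ⟨x, hx, y, hy, hxy⟩ := hadj c o hco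
      refine exists_hasLeg_of_connected hX (hc c) hx (exists_hasLeg_of_adj hX hxy hx ?_) hp
      obtain ⟨s, z, hz⟩ := ho y hy
      refine ⟨s, z, hz.mono ?_⟩
      intro x
      simp only [Finset.mem_insert, Finset.mem_singleton]
      tauto
  refine ⟨o, fun i => ?_⟩
  induction i with
  | zero =>
    intro _ j
    obtain ⟨a, b, hab⟩ := label_zero_subset hX j
    refine ⟨a, b, 0, isLeg_zero (hab.trans ?_)⟩
    intro x hx
    simp only [Finset.coe_insert, Finset.coe_singleton]
    exact Or.inr hx
  | succ i ih =>
    intro hi j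
    by_cases h : (label X (i + 1) j).Nonempty
    · obtain ⟨c, h, hc | ⟨h0, -⟩⟩ := h
      · exact ⟨c, hall c _ hc⟩
      · simp at h0
    · obtain ⟨a, b, hab⟩ := ih (by omega) j
      refine ⟨a, b, hab.of_source (t := 1) rfl (by omega) ?_⟩
      simp [Set.not_nonempty_iff_eq_empty.1 h]

end ShallowVortex

lemma exists_notMem_union_three (o a b c d e f : Fin 8) :
    ∃ x, x ∉ ({o, a, b} ∪ {o, c, d} ∪ {o, e, f} : Finset (Fin 8)) := by
  by_contra! h
  have hcard : ({o, a, b, c, d, e, f} : Finset (Fin 8)).card ≤ 7 :=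
    (Finset.card_insert_le _ _).trans (Nat.succ_le_succ Finset.card_le_six)
  have huniv : ({o, a, b, c, d, e, f} : Finset (Fin 8)) = Finset.univ := by
    refine Finset.eq_univ_of_forall fun x => ?_
    have := h x
    simp only [Finset.mem_union, Finset.mem_insert, Finset.mem_singleton] at this ⊢
    grind
  rw [huniv, Finset.card_univ, Fintype.card_fin] at hcard
  omega

/-- Curticapean–Xia, Section 1.1. For every `k ≥ 1`, the complete graph `K_8`
is not a minor of the shallow-vortex grid `V_k`; i.e. `K_8` is not a shallow-vortex minor. -/
theorem stmt_8 (k : ℕ) (hk : 1 ≤ k) :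
    ¬ IsMinorOf (⊤ : SimpleGraph (Fin 8)) (shallowVortexGrid k) := by
  rintro ⟨X, hne, hX, hc, hadj⟩
  have : NeZero (4 * k) := ⟨by omega⟩
  obtain ⟨o, ho⟩ := ShallowVortex.exists_hasLeg hne hX hc hadj
  obtain ⟨a₀, b₀, h₀⟩ := ho k le_rfl 0
  have htop : ∀ j, CylChain.HasLeg k (ShallowVortex.label X) {o, a₀, b₀} k j := by
    intro j
    have : ∀ m : ℕ, CylChain.HasLeg k (ShallowVortex.label X) {o, a₀, b₀} k (m : ZMod (4 * k)) := by
      intro m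
      induction m with
      | zero => simpa using h₀
      | succ m ih =>
        refine ih.of_source (t := 0) (by simp [CylChain.target]) le_rfl ?_
        rintro c ⟨h, -⟩
        omega
    simpa using this j.val
  have hlegs : ∀ i j, ∃ a b z, (i = k → a = a₀ ∧ b = b₀) ∧ (i = 0 → z = 0) ∧
      (i ≤ k → CylChain.IsLeg k (ShallowVortex.label X) {o, a, b} i j z) := by
    intro i j
    rcases Nat.eq_zero_or_pos i with rfl | hi
    · obtain ⟨a, b, hab⟩ := ShallowVortex.label_zero_subset hX j
      refine ⟨a, b, 0, fun h => by omega, fun _ => rfl, fun _ => CylChain.isLeg_zero ?_⟩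
      intro x hx
      simp only [Finset.coe_insert, Finset.coe_singleton]
      exact Or.inr (hab hx)
    rcases lt_trichotomy i k with hik | rfl | hik
    · obtain ⟨a, b, z, hz⟩ := ho i hik.le j
      exact ⟨a, b, z, fun h => by omega, fun h => by omega, fun _ => hz⟩
    · obtain ⟨z, hz⟩ := htop j
      exact ⟨a₀, b₀, z, fun _ => ⟨rfl, rfl⟩, fun h => by omega, fun _ => hz⟩
    · exact ⟨o, o, 0, fun h => by omega, fun _ => rfl, fun h => by omega⟩
  choose a b z hak hz0 hz using hlegs
  choose rep hrep using hne
  refine CylChain.false_of_forall_face_misses_label (k := k) (lab := ShallowVortex.label X)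
    (fun c => ((rep c).1, (rep c).2)) (fun c => ShallowVortex.mem_label (hrep c))
    (fun c => (rep c).1.2) ?_ (fun i j => {o, a i j, b i j}) z (fun i hi j => hz i j hi)
    (fun j => hz0 0 j rfl) ?_ (fun i _ j => exists_notMem_union_three _ _ _ _ _ _ _)
    (fun i _ j => exists_notMem_union_three _ _ _ _ _ _ _)
  · intro B f hv hh c c' hcB hcB'
    by_cases hcc : c = c'
    · rw [hcc]
    obtain ⟨x, hx, y, hy, hxy⟩ := hadj c c' hcc
    exact (ShallowVortex.eq_of_connected hv hh hcB (hc c) (hrep c) hx).trans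
      ((ShallowVortex.eq_of_adj hv hh hxy ⟨c, hcB, hx⟩ ⟨c', hcB', hy⟩).trans
        (ShallowVortex.eq_of_connected hv hh hcB' (hc c') hy (hrep c')))
  · obtain ⟨x, hx⟩ := exists_notMem_union_three o a₀ b₀ a₀ b₀ a₀ b₀
    refine ⟨x, fun j => ?_⟩
    rw [(hak k j rfl).1, (hak k j rfl).2]
    simpa using hx
end

section
/- Let θ ∈ ℕ and let (G, Ω) be a society whose depth is at most θ, i.e., every transaction in (G, Ω) has at most θ paths. Then (G, Ω) has a linear decomposition of adhesion at most 2θ. (The combinatorial content of Proposition 2.1 of the paper.) -/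
open SimpleGraph

/-- `a, b, c, d` occur in this cyclic order on `Fin n` (indices around the cycle):
measuring positions relative to `a`, the vertex `b` comes strictly after `a`, then `c`,
then `d`. -/
def CyclicOrdered {n : ℕ} (a b c d : Fin n) : Prop :=
  0 < (b - a).val ∧ (b - a).val < (c - a).val ∧ (c - a).val < (d - a).val

/-- A segment of the cyclic ordering on `Fin n`: a set `S` such that there are no
`s₁, s₂ ∈ S` and `t₁, t₂ ∉ S` occurring in the cyclic order `s₁, t₁, s₂, t₂`. -/
def IsSegment {n : ℕ} (S : Set (Fin n)) : Prop :=
  ¬ ∃ s₁ ∈ S, ∃ s₂ ∈ S, ∃ t₁ ∈ Sᶜ, ∃ t₂ ∈ Sᶜ, CyclicOrdered s₁ t₁ s₂ t₂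

/-- The society `(G, Ω)` (where `Ω` is the cyclic ordering of the vertices `ω 0, ω 1, …`)
has a transaction of order `m`: there are disjoint segments `A, B` of `Ω` and `m` pairwise
vertex-disjoint paths of `G`, each with one endpoint in `A` and the other in `B`. -/
def HasTransaction {W : Type*} (G : SimpleGraph W) {n : ℕ} (ω : Fin n ↪ W) (m : ℕ) : Prop :=
  ∃ A B : Set (Fin n), IsSegment A ∧ IsSegment B ∧ Disjoint A B ∧
    ∃ (a : Fin m → Fin n) (b : Fin m → Fin n)
      (p : ∀ i : Fin m, G.Walk (ω (a i)) (ω (b i))),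
      (∀ i, a i ∈ A) ∧ (∀ i, b i ∈ B) ∧ (∀ i, (p i).IsPath) ∧
      ∀ i j, i ≠ j → ∀ v : W, v ∈ (p i).support → v ∉ (p j).support

/-- `(L, R)` is a separation of the digraph `r` from `A` to `B`: the two sides cover all vertices,
and no arc leads from `L \ R` to `R \ L`. -/
structure IsSeparation {W : Type*} (r : W → W → Prop) (A B L R : Finset W) : Prop where
  left : A ⊆ L
  right : B ⊆ R
  cover : ∀ v, v ∈ L ∨ v ∈ R
  arc : ∀ u v, r u v → u ∈ R ∨ v ∈ L

/-- There are `k` pairwise disjoint vertex sets, each of which contains a directed walk of `r`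
from `A` to `B`. -/
def Linked {W : Type*} (r : W → W → Prop) (A B : Finset W) (k : ℕ) : Prop :=
  ∃ (T : Fin k → Set W) (a b : Fin k → W),
    (∀ i j, i ≠ j → ∀ v ∈ T i, v ∉ T j) ∧ (∀ i, a i ∈ A ∧ a i ∈ T i) ∧
    (∀ i, b i ∈ B ∧ b i ∈ T i) ∧
    ∀ i, Relation.ReflTransGen (fun u v => r u v ∧ u ∈ T i ∧ v ∈ T i) (a i) (b i)

theorem linked_of_le_card_inter {W : Type*} [DecidableEq W] (r : W → W → Prop)
    {A B : Finset W} {k : ℕ} (h : k ≤ (A ∩ B).card) : Linked r A B k := by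
  obtain ⟨C, hC, hk⟩ := Finset.exists_subset_card_eq h
  let e := C.equivFinOfCardEq hk
  have hmem : ∀ i, (e.symm i : W) ∈ A ∩ B := fun i => hC (e.symm i).2
  refine ⟨fun i => {(e.symm i : W)}, fun i => e.symm i, fun i => e.symm i, ?_,
    fun i => ⟨(Finset.mem_inter.1 (hmem i)).1, rfl⟩,
    fun i => ⟨(Finset.mem_inter.1 (hmem i)).2, rfl⟩, fun i => .refl⟩
  rintro i j hij v rfl hv
  exact hij (e.symm.injective (Subtype.ext hv))

theorem Relation.ReflTransGen.restrict_of_forward {W : Type*} {r r' : W → W → Prop} {L : Set W}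
    {T : Set W} (h : ∀ u v, r' u v → u ∈ L → r u v ∧ v ∈ L) {a b : W} (ha : a ∈ L)
    (hab : Relation.ReflTransGen (fun u v => r' u v ∧ u ∈ T ∧ v ∈ T) a b) :
    Relation.ReflTransGen (fun u v => r u v ∧ u ∈ T ∩ L ∧ v ∈ T ∩ L) a b ∧ b ∈ L := by
  induction hab with
  | refl => exact ⟨.refl, ha⟩
  | tail _ hs ih =>
    obtain ⟨hr, hL⟩ := h _ _ hs.1 ih.2
    exact ⟨ih.1.tail ⟨hr, ⟨hs.2.1, ih.2⟩, hs.2.2, hL⟩, hL⟩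

theorem Relation.ReflTransGen.restrict_of_backward {W : Type*} {r r' : W → W → Prop} {R : Set W}
    {T : Set W} (h : ∀ u v, r' u v → v ∈ R → r u v ∧ u ∈ R) {a b : W} (hb : b ∈ R)
    (hab : Relation.ReflTransGen (fun u v => r' u v ∧ u ∈ T ∧ v ∈ T) a b) :
    Relation.ReflTransGen (fun u v => r u v ∧ u ∈ T ∩ R ∧ v ∈ T ∩ R) a b ∧ a ∈ R := by
  induction hab using Relation.ReflTransGen.head_induction_on with
  | refl => exact ⟨.refl, hb⟩
  | head hs _ ih =>
    obtain ⟨hr, hR⟩ := h _ _ hs.1 ih.2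
    exact ⟨.head ⟨hr, ⟨hs.2.1, hR⟩, hs.2.2, ih.2⟩ ih.1, hR⟩

theorem Linked.restrict_left {W : Type*} {r r' : W → W → Prop} {A B L : Finset W} {k : ℕ}
    (h : ∀ u v, r' u v → u ∈ L → r u v ∧ v ∈ L) (hA : A ⊆ L) (hl : Linked r' A B k) :
    ∃ (T : Fin k → Set W) (a b : Fin k → W),
      (∀ i j, i ≠ j → ∀ v ∈ T i, v ∉ T j) ∧ (∀ i, a i ∈ A ∧ a i ∈ T i) ∧
      (∀ i, b i ∈ B ∧ b i ∈ T i) ∧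
      (∀ i, Relation.ReflTransGen (fun u v => r u v ∧ u ∈ T i ∧ v ∈ T i) (a i) (b i)) ∧
      ∀ i, T i ⊆ L := by
  obtain ⟨T, a, b, hd, ha, hb, hw⟩ := hl
  have key := fun i => (hw i).restrict_of_forward (L := L) h (hA (ha i).1)
  exact ⟨fun i => T i ∩ L, a, b, fun i j hij v hv hv' => hd i j hij v hv.1 hv'.1,
    fun i => ⟨(ha i).1, (ha i).2, hA (ha i).1⟩, fun i => ⟨(hb i).1, (hb i).2, (key i).2⟩,
    fun i => (key i).1, fun i => Set.inter_subset_right⟩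

theorem Linked.restrict_right {W : Type*} {r r' : W → W → Prop} {A B R : Finset W} {k : ℕ}
    (h : ∀ u v, r' u v → v ∈ R → r u v ∧ u ∈ R) (hB : B ⊆ R) (hl : Linked r' A B k) :
    ∃ (T : Fin k → Set W) (a b : Fin k → W),
      (∀ i j, i ≠ j → ∀ v ∈ T i, v ∉ T j) ∧ (∀ i, a i ∈ A ∧ a i ∈ T i) ∧
      (∀ i, b i ∈ B ∧ b i ∈ T i) ∧
      (∀ i, Relation.ReflTransGen (fun u v => r u v ∧ u ∈ T i ∧ v ∈ T i) (a i) (b i)) ∧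
      ∀ i, T i ⊆ R := by
  obtain ⟨T, a, b, hd, ha, hb, hw⟩ := hl
  have key := fun i => (hw i).restrict_of_backward (R := R) h (hB (hb i).1)
  exact ⟨fun i => T i ∩ R, a, b, fun i j hij v hv hv' => hd i j hij v hv.1 hv'.1,
    fun i => ⟨(ha i).1, (ha i).2, (key i).2⟩, fun i => ⟨(hb i).1, (hb i).2, hB (hb i).1⟩,
    fun i => (key i).1, fun i => Set.inter_subset_right⟩

/-- Representatives `b i` of `k` disjoint sets, taken in a set `P` of size `k`, exhaust `P`. -/
theorem exists_eq_of_disjoint_of_card_eq {W : Type*} {P : Finset W} {k : ℕ} (hP : P.card = k)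
    {T : Fin k → Set W} {b : Fin k → W} (hd : ∀ i j, i ≠ j → ∀ v ∈ T i, v ∉ T j)
    (hb : ∀ i, b i ∈ P ∧ b i ∈ T i) {p : W} (hp : p ∈ P) : ∃ i, b i = p := by
  have hinj : Function.Injective b := by
    intro i j hij
    by_contra hne
    exact hd i j hne _ (hb i).2 (hij ▸ (hb j).2)
  obtain ⟨i, -, hi⟩ := Finset.surjOn_of_injOn_of_card_le (s := Finset.univ) (t := P) b
    (fun i _ => (hb i).1) hinj.injOn (by simp [hP]) hp
  exact ⟨i, hi⟩

/-- Path systems on the two sides of a separation can be joined along an arc `(x, y)` crossing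
it. -/
theorem Linked.glue {W : Type*} [DecidableEq W] {r r₁ r₂ : W → W → Prop} {A B L R : Finset W}
    {k : ℕ} {x y : W} (hxy : r x y) (hxR : x ∉ R) (hyL : y ∉ L)
    (hk : (L ∩ R).card + 1 = k) (hA : A ⊆ L) (hB : B ⊆ R)
    (h₁ : ∀ u v, r₁ u v → u ∈ L → r u v ∧ v ∈ L)
    (h₂ : ∀ u v, r₂ u v → v ∈ R → r u v ∧ u ∈ R)
    (hl : Linked r₁ A (insert x (L ∩ R)) k) (hr : Linked r₂ (insert y (L ∩ R)) B k) :
    Linked r A B k := by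
  obtain ⟨T, a, b, hTd, ha, hb, hTw, hTL⟩ := hl.restrict_left h₁ hA
  obtain ⟨U, c, d, hUd, hc, hd, hUw, hUR⟩ := hr.restrict_right h₂ hB
  have hP : (insert x (L ∩ R)).card = k := by
    rw [Finset.card_insert_of_notMem (by simp [hxR]), hk]
  have hQ : (insert y (L ∩ R)).card = k := by
    rw [Finset.card_insert_of_notMem (by simp [hyL]), hk]
  have hj : ∀ i, ∃ j, c j = if b i = x then y else b i := by
    intro i
    apply exists_eq_of_disjoint_of_card_eq hQ hUd hc
    have := (hb i).1
    split_ifs with h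
    · simp
    · rw [Finset.mem_insert] at this ⊢
      tauto
  choose j hj using hj
  have hbinj : ∀ i i', b i = b i' → i = i' := by
    intro i i' h
    by_contra hne
    exact hTd i i' hne _ (hb i).2 (h ▸ (hb i').2)
  have hcinj : ∀ i i', c i = c i' → i = i' := by
    intro i i' h
    by_contra hne
    exact hUd i i' hne _ (hc i).2 (h ▸ (hc i').2)
  have hbL : ∀ i, b i ∈ L := fun i => hTL i (hb i).2
  have hjinj : ∀ i i', j i = j i' → i = i' := by
    intro i i' h
    have e := hj i
    rw [h, hj i'] at e
    apply hbinj
    have := hbL i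
    have := hbL i'
    split_ifs at e <;> simp_all
  have cross : ∀ i i' v, v ∈ T i → v ∈ U (j i') → i = i' := by
    intro i i' v hv hv'
    have hvS : v ∈ L ∩ R := Finset.mem_inter.2 ⟨hTL _ hv, hUR _ hv'⟩
    obtain ⟨i₀, hi₀⟩ := exists_eq_of_disjoint_of_card_eq hP hTd hb
      (Finset.mem_insert_of_mem hvS)
    obtain ⟨j₀, hj₀⟩ := exists_eq_of_disjoint_of_card_eq hQ hUd hc
      (Finset.mem_insert_of_mem hvS)
    have e₁ : i = i₀ := by
      by_contra hne
      exact hTd i i₀ hne v hv (hi₀ ▸ (hb i₀).2)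
    have e₂ : j i' = j₀ := by
      by_contra hne
      exact hUd _ j₀ hne v hv' (hj₀ ▸ (hc j₀).2)
    subst e₁ e₂
    rw [hj i'] at hj₀
    apply hbinj
    have := (Finset.mem_inter.1 hvS).1
    split_ifs at hj₀ <;> simp_all
  refine ⟨fun i => T i ∪ U (j i), a, fun i => d (j i), ?_, fun i => ⟨(ha i).1, .inl (ha i).2⟩,
    fun i => ⟨(hd _).1, .inr (hd _).2⟩, ?_⟩
  · rintro i i' hne v (hv | hv) (hv' | hv')
    · exact hTd i i' hne v hv hv'
    · exact hne (cross _ _ v hv hv')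
    · exact hne (cross _ _ v hv' hv).symm
    · exact hUd _ _ (fun h => hne (hjinj _ _ h)) v hv hv'
  · intro i
    have w₁ : Relation.ReflTransGen
        (fun u v => r u v ∧ u ∈ T i ∪ U (j i) ∧ v ∈ T i ∪ U (j i)) (a i) (b i) :=
      Relation.ReflTransGen.mono (fun u v h => ⟨h.1, .inl h.2.1, .inl h.2.2⟩) _ _ (hTw i)
    have w₂ : Relation.ReflTransGen
        (fun u v => r u v ∧ u ∈ T i ∪ U (j i) ∧ v ∈ T i ∪ U (j i)) (c (j i)) (d (j i)) :=
      Relation.ReflTransGen.mono (fun u v h => ⟨h.1, .inr h.2.1, .inr h.2.2⟩) _ _ (hUw (j i))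
    refine w₁.trans (.trans ?_ w₂)
    have e := hj i
    split_ifs at e with hx
    · exact .single ⟨by rw [hx, e]; exact hxy, .inl (hb i).2, .inr (hc _).2⟩
    · rw [e]

/-- Menger's theorem for digraphs. -/
theorem linked_or_exists_isSeparation {W : Type*} [Fintype W] [DecidableEq W] (k : ℕ)
    (r : W → W → Prop) (A B : Finset W) :
    Linked r A B k ∨ ∃ L R, IsSeparation r A B L R ∧ (L ∩ R).card < k := by
  induction hN : {e : W × W | r e.1 e.2}.ncard using Nat.strong_induction_on
    generalizing r A B with
  | _ N ih =>
  subst hN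
  by_cases hr : ∃ x y, r x y
  swap
  · push Not at hr
    rcases le_or_gt k (A ∩ B).card with h | h
    · exact .inl (linked_of_le_card_inter r h)
    · refine .inr ⟨A, B ∪ Aᶜ, ⟨subset_rfl, Finset.subset_union_left, ?_, ?_⟩, ?_⟩
      · intro v
        simp only [Finset.mem_union, Finset.mem_compl]
        tauto
      · exact fun u v h => (hr u v h).elim
      · simpa [Finset.inter_union_distrib_left] using h
  obtain ⟨x, y, hxy⟩ := hr
  have ih' : ∀ r' : W → W → Prop, (∀ u v, r' u v → r u v) → ¬ r' x y → ∀ A B : Finset W,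
      Linked r' A B k ∨ ∃ L R, IsSeparation r' A B L R ∧ (L ∩ R).card < k := by
    intro r' hle hne A B
    refine ih _ (Set.ncard_lt_ncard ?_ (Set.toFinite _)) r' A B rfl
    exact ⟨fun e he => hle _ _ he, fun h => hne (h (show (x, y) ∈ _ from hxy))⟩
  rcases ih' (fun u v => r u v ∧ ¬ (u = x ∧ v = y)) (fun u v h => h.1) (by simp) A B with
    h | ⟨L, R, hLR, hlt⟩
  · obtain ⟨T, a, b, h₁, h₂, h₃, h₄⟩ := h
    exact .inl ⟨T, a, b, h₁, h₂, h₃, fun i =>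
      Relation.ReflTransGen.mono (fun u v h => ⟨h.1.1, h.2⟩) _ _ (h₄ i)⟩
  obtain ⟨hA, hB, hcov, harc⟩ := hLR
  by_cases hcross : x ∈ R ∨ y ∈ L
  · refine .inr ⟨L, R, ⟨hA, hB, hcov, fun u v huv => ?_⟩, hlt⟩
    by_cases he : u = x ∧ v = y
    · rwa [he.1, he.2]
    · exact harc u v ⟨huv, he⟩
  push Not at hcross
  obtain ⟨hxR, hyL⟩ := hcross
  have hxL : x ∈ L := (hcov x).resolve_right hxR
  have hyR : y ∈ R := (hcov y).resolve_left hyL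
  by_cases hk : (L ∩ R).card + 1 = k
  swap
  · refine .inr ⟨L, insert x R, ⟨hA, hB.trans (Finset.subset_insert _ _), fun v => ?_,
      fun u v huv => ?_⟩, ?_⟩
    · exact (hcov v).imp_right (Finset.mem_insert_of_mem ·)
    · by_cases he : u = x
      · simp [he]
      · exact (harc u v ⟨huv, fun h => he h.1⟩).imp_left (Finset.mem_insert_of_mem ·)
    · rw [Finset.inter_insert_of_mem hxL]
      exact (Finset.card_insert_le _ _).trans_lt (by omega)
  rcases ih' (fun u v => r u v ∧ u ∈ L ∧ u ∉ insert x (L ∩ R)) (fun u v h => h.1) (by simp) A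
    (insert x (L ∩ R)) with hl | ⟨L', R', ⟨hA', hB', hcov', harc'⟩, hlt'⟩
  swap
  · refine .inr ⟨L ∩ L', R ∪ R', ⟨Finset.subset_inter hA hA',
      hB.trans Finset.subset_union_left, fun v => ?_, fun u v huv => ?_⟩, ?_⟩
    · have := hcov v
      have := hcov' v
      simp only [Finset.mem_inter, Finset.mem_union]
      tauto
    · by_contra hcon
      simp only [Finset.mem_inter, Finset.mem_union, not_or, not_and] at hcon
      obtain ⟨⟨huR, huR'⟩, hv⟩ := hcon
      have huP : u ∉ insert x (L ∩ R) := fun h => huR' (hB' h)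
      have hux : u ≠ x := fun h => huP (by simp [h])
      have hvL := (harc u v ⟨huv, fun h => hux h.1⟩).resolve_left huR
      exact hv hvL ((harc' u v ⟨huv, (hcov u).resolve_right huR, huP⟩).resolve_left huR')
    · refine (Finset.card_le_card fun v hv => ?_).trans_lt hlt'
      have := @hB' v
      simp only [Finset.mem_inter, Finset.mem_union, Finset.mem_insert] at hv this ⊢
      tauto
  rcases ih' (fun u v => r u v ∧ v ∈ R ∧ v ∉ insert y (L ∩ R)) (fun u v h => h.1) (by simp)
    (insert y (L ∩ R)) B with hr | ⟨L', R', ⟨hA', hB', hcov', harc'⟩, hlt'⟩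
  swap
  · refine .inr ⟨L ∪ L', R ∩ R', ⟨hA.trans Finset.subset_union_left,
      Finset.subset_inter hB hB', fun v => ?_, fun u v huv => ?_⟩, ?_⟩
    · have := hcov v
      have := hcov' v
      simp only [Finset.mem_inter, Finset.mem_union]
      tauto
    · by_contra hcon
      simp only [Finset.mem_inter, Finset.mem_union, not_or, not_and] at hcon
      obtain ⟨hu, hvL, hvL'⟩ := hcon
      have hvP : v ∉ insert y (L ∩ R) := fun h => hvL' (hA' h)
      have hvy : v ≠ y := fun h => hvP (by simp [h])
      have huR := (harc u v ⟨huv, fun h => hvy h.2⟩).resolve_right hvL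
      exact hu huR ((harc' u v ⟨huv, (hcov v).resolve_left hvL, hvP⟩).resolve_right hvL')
    · refine (Finset.card_le_card fun v hv => ?_).trans_lt hlt'
      have := @hA' v
      simp only [Finset.mem_inter, Finset.mem_union, Finset.mem_insert] at hv this ⊢
      tauto
  refine .inl (Linked.glue hxy hxR hyL hk hA hB ?_ ?_ hl hr)
  · rintro u v ⟨huv, -, huP⟩ huL
    have huR : u ∉ R := fun h => huP (by simp [h, huL])
    have hux : u ≠ x := fun h => huP (by simp [h])
    exact ⟨huv, (harc u v ⟨huv, fun h => hux h.1⟩).resolve_left huR⟩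
  · rintro u v ⟨huv, -, hvP⟩ hvR
    have hvL : v ∉ L := fun h => hvP (by simp [h, hvR])
    have hvy : v ≠ y := fun h => hvP (by simp [h])
    exact ⟨huv, (harc u v ⟨huv, fun h => hvy h.2⟩).resolve_right hvL⟩

theorem IsSeparation.inter_union {W : Type*} [DecidableEq W] {r : W → W → Prop}
    {A B A' B' L R L' R' : Finset W} (h : IsSeparation r A B L R)
    (h' : IsSeparation r A' B' L' R') (hA : A ⊆ A') :
    IsSeparation r A B (L ∩ L') (R ∪ R') := by
  refine ⟨Finset.subset_inter h.left (hA.trans h'.left), h.right.trans Finset.subset_union_left,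
    fun v => ?_, fun u v huv => ?_⟩
  · have := h.cover v
    have := h'.cover v
    simp only [Finset.mem_inter, Finset.mem_union]
    tauto
  · have := h.arc u v huv
    have := h'.arc u v huv
    simp only [Finset.mem_inter, Finset.mem_union]
    tauto

theorem IsSeparation.union_inter {W : Type*} [DecidableEq W] {r : W → W → Prop}
    {A B A' B' L R L' R' : Finset W} (h : IsSeparation r A B L R)
    (h' : IsSeparation r A' B' L' R') (hB : B' ⊆ B) :
    IsSeparation r A' B' (L ∪ L') (R ∩ R') := by
  refine ⟨h'.left.trans Finset.subset_union_right, Finset.subset_inter (hB.trans h.right) h'.right,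
    fun v => ?_, fun u v huv => ?_⟩
  · have := h.cover v
    have := h'.cover v
    simp only [Finset.mem_inter, Finset.mem_union]
    tauto
  · have := h.arc u v huv
    have := h'.arc u v huv
    simp only [Finset.mem_inter, Finset.mem_union]
    tauto

/-- The order of separations is modular. -/
theorem card_inter_add_card_inter_of_cover {W : Type*} [Fintype W] [DecidableEq W]
    {L R L' R' : Finset W} (h : ∀ v, v ∈ L ∨ v ∈ R) (h' : ∀ v, v ∈ L' ∨ v ∈ R') :
    ((L ∩ L') ∩ (R ∪ R')).card + ((L ∪ L') ∩ (R ∩ R')).card =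
      (L ∩ R).card + (L' ∩ R').card := by
  simp only [Finset.card_eq_sum_ones]
  have key : ∀ S : Finset W, ∑ _x ∈ S, 1 = ∑ x : W, if x ∈ S then 1 else 0 := by simp
  simp only [key, ← Finset.sum_add_distrib]
  refine Finset.sum_congr rfl fun v _ => ?_
  have := h v
  have := h' v
  simp only [Finset.mem_inter, Finset.mem_union]
  by_cases v ∈ L <;> by_cases v ∈ R <;> by_cases v ∈ L' <;> by_cases v ∈ R' <;> simp_all

/-- A separation from `A` to `B` of minimum order and, subject to that, with a minimal left side
and a maximal right side. -/
structure IsExtremalSeparation {W : Type*} [DecidableEq W] (r : W → W → Prop)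
    (A B L R : Finset W) : Prop extends IsSeparation r A B L R where
  card_le : ∀ L' R', IsSeparation r A B L' R' → (L ∩ R).card ≤ (L' ∩ R').card
  eq_of_subset : ∀ L' R', IsSeparation r A B L' R' → (L' ∩ R').card ≤ (L ∩ R).card →
    L' ⊆ L → R ⊆ R' → L' = L ∧ R' = R

theorem exists_isExtremalSeparation {W : Type*} [Fintype W] [DecidableEq W] (r : W → W → Prop)
    (A B : Finset W) : ∃ L R, IsExtremalSeparation r A B L R := by
  let F : Set (Finset W × Finset W) := {p | IsSeparation r A B p.1 p.2}
  have hF : F.Nonempty := ⟨(Finset.univ, Finset.univ), by constructor <;> simp⟩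
  obtain ⟨p, hp, hpmin⟩ := Set.exists_min_image F (fun p => (p.1 ∩ p.2).card) (Set.toFinite _) hF
  obtain ⟨q, hq, hqmin⟩ := Set.exists_min_image
    {q ∈ F | (q.1 ∩ q.2).card ≤ (p.1 ∩ p.2).card} (fun q => q.1.card + q.2ᶜ.card)
    (Set.toFinite _) ⟨p, hp, le_rfl⟩
  refine ⟨q.1, q.2, hq.1, fun L' R' h => hq.2.trans (hpmin (L', R') h), ?_⟩
  intro L' R' h hc hL hR
  have := hqmin (L', R') ⟨h, hc.trans hq.2⟩
  have h₁ := Finset.card_le_card hL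
  have h₂ := Finset.card_le_card (Finset.compl_subset_compl.2 hR)
  dsimp only at this
  exact ⟨Finset.eq_of_subset_of_card_le hL (by omega),
    compl_injective (Finset.eq_of_subset_of_card_le (Finset.compl_subset_compl.2 hR) (by omega))⟩

theorem IsExtremalSeparation.nested {W : Type*} [Fintype W] [DecidableEq W] {r : W → W → Prop}
    {A B A' B' L R L' R' : Finset W} (h : IsExtremalSeparation r A B L R)
    (h' : IsExtremalSeparation r A' B' L' R') (hA : A ⊆ A') (hB : B' ⊆ B) :
    L ⊆ L' ∧ R' ⊆ R := by
  have s₁ := h.toIsSeparation.inter_union h'.toIsSeparation hA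
  have s₂ := h.toIsSeparation.union_inter h'.toIsSeparation hB
  have hmod := card_inter_add_card_inter_of_cover h.cover h'.cover
  have hle := h'.card_le _ _ s₂
  obtain ⟨e₁, e₂⟩ := h.eq_of_subset _ _ s₁ (by omega) Finset.inter_subset_left
    Finset.subset_union_left
  exact ⟨Finset.inter_eq_left.1 e₁, Finset.union_eq_left.1 e₂⟩

theorem isSegment_setOf_val_lt {n : ℕ} (j : ℕ) : IsSegment {i : Fin n | i.val < j} := by
  rintro ⟨s₁, hs₁, s₂, hs₂, t₁, ht₁, t₂, ht₂, h⟩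
  simp only [Set.mem_ofPred_eq, Set.mem_compl_iff, not_lt, CyclicOrdered] at *
  rw [Fin.sub_val_of_le (Fin.le_def.2 (by omega : s₁.val ≤ t₁.val)),
    Fin.sub_val_of_le (Fin.le_def.2 (by omega : s₁.val ≤ t₂.val))] at h
  rcases le_or_gt s₁ s₂ with h' | h'
  · rw [Fin.sub_val_of_le h'] at h
    omega
  · rw [Fin.coe_sub_iff_lt.2 h'] at h
    omega

theorem isSegment_setOf_le_val {n : ℕ} (j : ℕ) : IsSegment {i : Fin n | j ≤ i.val} := by
  rintro ⟨s₁, hs₁, s₂, hs₂, t₁, ht₁, t₂, ht₂, h⟩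
  simp only [Set.mem_ofPred_eq, Set.mem_compl_iff, not_le, CyclicOrdered] at *
  rw [Fin.coe_sub_iff_lt.2 (Fin.lt_def.2 (by omega : t₁.val < s₁.val)),
    Fin.coe_sub_iff_lt.2 (Fin.lt_def.2 (by omega : t₂.val < s₁.val))] at h
  rcases le_or_gt s₁ s₂ with h' | h'
  · rw [Fin.sub_val_of_le h'] at h
    omega
  · rw [Fin.coe_sub_iff_lt.2 h'] at h
    omega

theorem exists_walk_of_reflTransGen {W : Type*} {G : SimpleGraph W} {T : Set W} {a b : W}
    (ha : a ∈ T) (h : Relation.ReflTransGen (fun u v => G.Adj u v ∧ u ∈ T ∧ v ∈ T) a b) :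
    ∃ p : G.Walk a b, ∀ v ∈ p.support, v ∈ T := by
  induction h using Relation.ReflTransGen.head_induction_on with
  | refl => exact ⟨.nil, by simpa using ha⟩
  | head hs _ ih =>
    obtain ⟨p, hp⟩ := ih hs.2.2
    refine ⟨.cons hs.1 p, ?_⟩
    simpa [hs.2.1] using hp

theorem HasTransaction.of_linked {W : Type*} [DecidableEq W] {G : SimpleGraph W} {n : ℕ}
    {ω : Fin n ↪ W} {k j : ℕ}
    (h : Linked G.Adj ({i : Fin n | i.val < j}.toFinset.map ω)
      ({i : Fin n | j ≤ i.val}.toFinset.map ω) k) : HasTransaction G ω k := by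
  obtain ⟨T, a, b, hd, ha, hb, hw⟩ := h
  choose p hp using fun i => exists_walk_of_reflTransGen (ha i).2 (hw i)
  have ha' : ∀ i, ∃ c : Fin n, c.val < j ∧ ω c = a i := fun i => by simpa using (ha i).1
  have hb' : ∀ i, ∃ c : Fin n, j ≤ c.val ∧ ω c = b i := fun i => by simpa using (hb i).1
  choose c hc hca using ha'
  choose d hd' hdb using hb'
  refine ⟨{i | i.val < j}, {i | j ≤ i.val}, isSegment_setOf_val_lt j, isSegment_setOf_le_val j,
    ?_, c, d, fun i => ((p i).copy (hca i).symm (hdb i).symm).bypass, hc, hd',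
    fun i => SimpleGraph.Walk.bypass_isPath _, ?_⟩
  · rw [Set.disjoint_left]
    intro i hi hi'
    simp only [Set.mem_ofPred_eq] at hi hi'
    omega
  · have hsub : ∀ i, ∀ v ∈ ((p i).copy (hca i).symm (hdb i).symm).bypass.support, v ∈ T i := by
      intro i v hv
      have := SimpleGraph.Walk.support_bypass_subset_support _ hv
      exact hp i v (by simpa using this)
    exact fun i i' hne v hv hv' => hd i i' hne v (hsub _ _ hv) (hsub _ _ hv')

/-- Proposition 2.1. Let `(G, Ω)` be a society (with `V(Ω)` enumerated in
cyclic order by the embedding `ω : Fin n ↪ V(G)`, `n ≥ 1`) whose depth is at most `θ`, i.e.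
every transaction has at most `θ` paths.  Then `(G, Ω)` has a linear decomposition of adhesion
at most `2θ`: there are sets `X 0, …, X (n-1)` and a rotation `s` such that the enumeration
`v_i = ω (s + i)` of `V(Ω)` occurs in this order in `Ω`, `v_i ∈ X i`, the `X i` cover `V(G)`,
every edge lies in some `X i`, each vertex occupies an interval of indices, and consecutive
sets intersect in at most `2θ` vertices. -/
theorem stmt_10 {W : Type*} [Fintype W] (G : SimpleGraph W)
    (n : ℕ) (hn : 0 < n) (ω : Fin n ↪ W) (θ : ℕ)
    (hdepth : ∀ m : ℕ, HasTransaction G ω m → m ≤ θ) :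
    ∃ (X : Fin n → Set W) (s : Fin n),
      (∀ i : Fin n, ω (s + i) ∈ X i) ∧
      (⋃ i, X i) = Set.univ ∧
      (∀ v w : W, G.Adj v w → ∃ i, v ∈ X i ∧ w ∈ X i) ∧
      (∀ x : W, ∀ i j l : Fin n, i ≤ j → j ≤ l → x ∈ X i → x ∈ X l → x ∈ X j) ∧
      ∀ (i : ℕ) (h : i + 1 < n),
        (X ⟨i, Nat.lt_of_succ_lt h⟩ ∩ X ⟨i + 1, h⟩).ncard ≤ 2 * θ := by
  classical
  have hex := fun j : ℕ => exists_isExtremalSeparation G.Adj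
    ({i : Fin n | i.val < j}.toFinset.map ω) ({i : Fin n | j ≤ i.val}.toFinset.map ω)
  choose L R hLR using hex
  have hord : ∀ j, (L j ∩ R j).card ≤ θ := by
    intro j
    rcases linked_or_exists_isSeparation (θ + 1) G.Adj ({i : Fin n | i.val < j}.toFinset.map ω)
      ({i : Fin n | j ≤ i.val}.toFinset.map ω) with h | ⟨L', R', h, hlt⟩
    · exact absurd (hdepth _ (HasTransaction.of_linked h)) (by omega)
    · exact ((hLR j).card_le L' R' h).trans (by omega)
  have hnest : ∀ i j, i ≤ j → L i ⊆ L j ∧ R j ⊆ R i := by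
    intro i j hij
    refine (hLR i).nested (hLR j) (Finset.map_subset_map.2 fun c hc => ?_)
      (Finset.map_subset_map.2 fun c hc => ?_) <;>
    · simp only [Set.mem_toFinset, Set.mem_ofPred_eq] at hc ⊢
      omega
  have hLmem : ∀ (i : Fin n) j, i.val < j → ω i ∈ L j := fun i j h =>
    (hLR j).left (Finset.mem_map_of_mem ω (by simpa using h))
  have hRmem : ∀ (i : Fin n) j, j ≤ i.val → ω i ∈ R j := fun i j h =>
    (hLR j).right (Finset.mem_map_of_mem ω (by simpa using h))
  -- The bag of the first index whose left side contains `S` contains `S`.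
  have hfirst : ∀ S : Set W, (∀ j, S ⊆ L j ∨ S ⊆ R j) → ∃ i : Fin n, ∀ x ∈ S,
      (i.val + 1 = n ∨ x ∈ L (i + 1)) ∧ (i.val = 0 ∨ x ∈ R i) := by
    intro S hS
    have hE : ∃ i, i + 1 = n ∨ S ⊆ L (i + 1) := ⟨n - 1, .inl (by omega)⟩
    have hlt : Nat.find hE < n := by
      have := Nat.find_min' hE (m := n - 1) (.inl (by omega))
      omega
    refine ⟨⟨Nat.find hE, hlt⟩, fun x hx => ⟨(Nat.find_spec hE).imp_right (· hx), ?_⟩⟩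
    rcases Nat.eq_zero_or_pos (Nat.find hE) with h0 | h0
    · exact .inl h0
    · have := Nat.find_min hE (m := Nat.find hE - 1) (by omega)
      rw [not_or, Nat.sub_add_cancel h0] at this
      exact .inr ((hS _).resolve_left this.2 hx)
  refine ⟨fun i => {x | (i.val + 1 = n ∨ x ∈ L (i + 1)) ∧ (i.val = 0 ∨ x ∈ R i)}, ⟨0, hn⟩,
    ?_, ?_, ?_, ?_, ?_⟩
  · intro i
    have : (⟨0, hn⟩ + i : Fin n) = i := by
      ext
      simp [Fin.val_add, Nat.mod_eq_of_lt i.2]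
    rw [this]
    exact ⟨.inr (hLmem i _ (by omega)), .inr (hRmem i _ le_rfl)⟩
  · refine Set.eq_univ_of_forall fun x => Set.mem_iUnion.2 ?_
    obtain ⟨i, hi⟩ := hfirst {x} fun j => by simpa using (hLR j).cover x
    exact ⟨i, hi x rfl⟩
  · intro v w hvw
    obtain ⟨i, hi⟩ := hfirst {v, w} fun j => by
      have h₁ := (hLR j).arc v w hvw
      have h₂ := (hLR j).arc w v hvw.symm
      have h₃ := (hLR j).cover v
      have h₄ := (hLR j).cover w
      simp only [Set.insert_subset_iff, Set.singleton_subset_iff, Finset.mem_coe]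
      tauto
    exact ⟨i, hi v (by simp), hi w (by simp)⟩
  · intro x i j l hij hjl hi hl
    rw [Fin.le_def] at hij hjl
    refine ⟨?_, ?_⟩
    · rcases hi.1 with h | h
      · exact .inl (by omega)
      · exact .inr ((hnest _ _ (by omega)).1 h)
    · rcases hl.2 with h | h
      · exact .inl (by omega)
      · exact .inr ((hnest _ _ hjl).2 h)
  · intro i h
    have hsub : {x | (i + 1 = n ∨ x ∈ L (i + 1)) ∧ (i = 0 ∨ x ∈ R i)} ∩
        {x | (i + 1 + 1 = n ∨ x ∈ L (i + 1 + 1)) ∧ (i + 1 = 0 ∨ x ∈ R (i + 1))} ⊆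
        ((L (i + 1) ∩ R (i + 1) : Finset W) : Set W) := by
      rintro x ⟨⟨h₁, -⟩, -, h₂⟩
      exact Finset.mem_coe.2 (Finset.mem_inter.2
        ⟨h₁.resolve_left (by omega), h₂.resolve_left (by omega)⟩)
    have hc := Set.ncard_le_ncard hsub (Set.toFinite _)
    rw [Set.ncard_coe_finset] at hc
    have := hord (i + 1)
    exact hc.trans (by omega)
end
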